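/- arXiv:2408.04372 — 4 statements merged into one kernel-verified Lean document; each statement's English description precedes it below -/
import Mathlib

section
/- Let M_τ, A_τ ∈ ℝ^{N_t×N_t} with M_τ invertible, M_h, A_h ∈ ℝ^{N_x×N_x}, α ∈ ℝ^{N_t}, and let u_prev, v_prev ∈ ℝ^{N_x} and f ∈ ℝ^{N_t·N_x} be given. Then a pair (u, v) ∈ ℝ^{N_t·N_x} × ℝ^{N_t·N_x} satisfies the coupled system (i) (M_τ ⊗ I_{N_x}) v = (A_τ ⊗ I_{N_x}) u − α ⊗ u_prev and (ii) (A_τ ⊗ M_h) v + (M_τ ⊗ A_h) u = (M_τ ⊗ M_h) f + α ⊗ (M_h v_prev), if and only if u satisfies the condensed equation (M_τ ⊗ A_h + (A_τ M_τ⁻¹ A_τ) ⊗ M_h) u = (M_τ ⊗ M_h) f + α ⊗ (M_h v_prev) + (A_τ M_τ⁻¹ α) ⊗ (M_h u_prev) and v is given by the vector update v = (M_τ⁻¹ A_τ ⊗ I_{N_x}) u − (M_τ⁻¹ α) ⊗ u_prev. -/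
open Matrix Kronecker

/-- Kronecker product `a ⊗ w` of a temporal vector `a ∈ ℝ^{N_t}` and a spatial vector
`w ∈ ℝ^{N_x}`, viewed as a stacked space-time vector whose `i`-th block is `a i • w`. -/
def vkron {m n : ℕ} (a : Fin m → ℝ) (w : Fin n → ℝ) : Fin m × Fin n → ℝ :=
  fun p => a p.1 * w p.2

theorem kronecker_mulVec_vkron {m n : ℕ} (P : Matrix (Fin m) (Fin m) ℝ)
    (Q : Matrix (Fin n) (Fin n) ℝ) (a : Fin m → ℝ) (w : Fin n → ℝ) :
    (P ⊗ₖ Q) *ᵥ vkron a w = vkron (P *ᵥ a) (Q *ᵥ w) := by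
  ext ⟨i, j⟩
  simp only [mulVec, dotProduct, vkron, kroneckerMap_apply, Fintype.sum_prod_type,
    Finset.sum_mul_sum]
  exact Finset.sum_congr rfl fun _ _ => Finset.sum_congr rfl fun _ _ => by ring

/-- Condensation of the single-step CG(p)–DG(k) system for the acoustic wave equation
written as a first-order system: the coupled displacement–velocity system is equivalent
to solving only for the displacement `u` via the condensed Schur-type operator
`S = M_τ ⊗ A_h + (A_τ M_τ⁻¹ A_τ) ⊗ M_h` and recovering the velocity by a vector update
(paper eqs. (15a)–(15b)). -/
theorem condensed_wave_dg
    (Nt Nx : ℕ)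
    (Mτ Aτ : Matrix (Fin Nt) (Fin Nt) ℝ) (hMτ : IsUnit Mτ.det)
    (Mh Ah : Matrix (Fin Nx) (Fin Nx) ℝ)
    (α : Fin Nt → ℝ) (uprev vprev : Fin Nx → ℝ)
    (f : Fin Nt × Fin Nx → ℝ)
    (u v : Fin Nt × Fin Nx → ℝ) :
    ((Mτ ⊗ₖ (1 : Matrix (Fin Nx) (Fin Nx) ℝ)) *ᵥ v
        = (Aτ ⊗ₖ (1 : Matrix (Fin Nx) (Fin Nx) ℝ)) *ᵥ u - vkron α uprev ∧
      (Aτ ⊗ₖ Mh) *ᵥ v + (Mτ ⊗ₖ Ah) *ᵥ u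
        = (Mτ ⊗ₖ Mh) *ᵥ f + vkron α (Mh *ᵥ vprev)) ↔
    ((Mτ ⊗ₖ Ah + (Aτ * Mτ⁻¹ * Aτ) ⊗ₖ Mh) *ᵥ u
        = (Mτ ⊗ₖ Mh) *ᵥ f + vkron α (Mh *ᵥ vprev)
          + vkron ((Aτ * Mτ⁻¹) *ᵥ α) (Mh *ᵥ uprev) ∧
      v = ((Mτ⁻¹ * Aτ) ⊗ₖ (1 : Matrix (Fin Nx) (Fin Nx) ℝ)) *ᵥ u
          - vkron (Mτ⁻¹ *ᵥ α) uprev) := by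
  have velocity_iff : (Mτ ⊗ₖ (1 : Matrix (Fin Nx) (Fin Nx) ℝ)) *ᵥ v
        = (Aτ ⊗ₖ (1 : Matrix (Fin Nx) (Fin Nx) ℝ)) *ᵥ u - vkron α uprev ↔
      v = ((Mτ⁻¹ * Aτ) ⊗ₖ (1 : Matrix (Fin Nx) (Fin Nx) ℝ)) *ᵥ u
          - vkron (Mτ⁻¹ *ᵥ α) uprev := by
    constructor
    · intro h
      have h' := congrArg ((Mτ⁻¹ ⊗ₖ (1 : Matrix (Fin Nx) (Fin Nx) ℝ)) *ᵥ ·) h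
      simpa [mulVec_sub, mulVec_mulVec, ← mul_kronecker_mul, kronecker_mulVec_vkron,
        nonsing_inv_mul _ hMτ] using h'
    · rintro rfl
      simp [mulVec_sub, mulVec_mulVec, ← mul_kronecker_mul, kronecker_mulVec_vkron,
        mul_nonsing_inv_cancel_left _ _ hMτ, mul_nonsing_inv _ hMτ]
  rw [velocity_iff, and_comm]
  refine and_congr_left ?_
  rintro rfl
  simp only [mulVec_sub, mulVec_mulVec, ← mul_kronecker_mul, kronecker_mulVec_vkron, add_mulVec,
    mul_one, Matrix.mul_assoc]
  rw [sub_add_eq_add_sub, sub_eq_iff_eq_add, add_comm (_ *ᵥ u) (_ *ᵥ u)]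
end

section
/- Let M_τ, A_τ ∈ ℝ^{N_t×N_t} with M_τ invertible, M_h, A_h ∈ ℝ^{N_x×N_x}, α, β ∈ ℝ^{N_t}, and let u_prev, v_prev, ĝ ∈ ℝ^{N_x} and f ∈ ℝ^{N_t·N_x} be given. Then a pair (u, v) ∈ ℝ^{N_t·N_x} × ℝ^{N_t·N_x} satisfies the coupled system (i) (M_τ ⊗ I_{N_x}) v = (A_τ ⊗ I_{N_x}) u − α ⊗ u_prev + β ⊗ v_prev and (ii) (A_τ ⊗ M_h) v + (M_τ ⊗ A_h) u = (M_τ ⊗ M_h) f − β ⊗ (M_h ĝ) + β ⊗ (A_h u_prev) + α ⊗ (M_h v_prev), if and only if u satisfies the condensed equation (M_τ ⊗ A_h + (A_τ M_τ⁻¹ A_τ) ⊗ M_h) u = (M_τ ⊗ M_h) f − β ⊗ (M_h ĝ) + β ⊗ (A_h u_prev) + (A_τ M_τ⁻¹ α) ⊗ (M_h u_prev) + (α − A_τ M_τ⁻¹ β) ⊗ (M_h v_prev) and v is given by the vector update v = (M_τ⁻¹ A_τ ⊗ I_{N_x}) u − (M_τ⁻¹ α) ⊗ u_prev + (M_τ⁻¹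 β) ⊗ v_prev. -/
open Matrix Kronecker

theorem sub_vkron {m n : ℕ} (a b : Fin m → ℝ) (w : Fin n → ℝ) :
    vkron (a - b) w = vkron a w - vkron b w := by
  ext p
  simp [vkron, sub_mul]

theorem kronecker_one_mulVec_eq_iff {m n : ℕ} {P : Matrix (Fin m) (Fin m) ℝ}
    (hP : IsUnit P.det) (x y : Fin m × Fin n → ℝ) :
    (P ⊗ₖ (1 : Matrix (Fin n) (Fin n) ℝ)) *ᵥ x = y ↔
      x = (P⁻¹ ⊗ₖ (1 : Matrix (Fin n) (Fin n) ℝ)) *ᵥ y := by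
  constructor
  · rintro rfl
    simp [mulVec_mulVec, ← mul_kronecker_mul, nonsing_inv_mul P hP]
  · rintro rfl
    simp [mulVec_mulVec, ← mul_kronecker_mul, mul_nonsing_inv P hP]

/-- Condensation of the single-step CG(p)–CGP(k) system for the acoustic wave equation
written as a first-order system: the coupled displacement–velocity system is equivalent
to solving only for the displacement `u` via the condensed operator
`S = M_τ ⊗ A_h + (A_τ M_τ⁻¹ A_τ) ⊗ M_h` and recovering the velocity by a vector update
(paper eqs. (24a)–(24b); `ĝ` is the right-hand-side datum `f_{n-1}^{N_t}` from the
previous interval endpoint). -/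
theorem condensed_wave_cgp
    (Nt Nx : ℕ)
    (Mτ Aτ : Matrix (Fin Nt) (Fin Nt) ℝ) (hMτ : IsUnit Mτ.det)
    (Mh Ah : Matrix (Fin Nx) (Fin Nx) ℝ)
    (α β : Fin Nt → ℝ) (uprev vprev ghat : Fin Nx → ℝ)
    (f : Fin Nt × Fin Nx → ℝ)
    (u v : Fin Nt × Fin Nx → ℝ) :
    ((Mτ ⊗ₖ (1 : Matrix (Fin Nx) (Fin Nx) ℝ)) *ᵥ v
        = (Aτ ⊗ₖ (1 : Matrix (Fin Nx) (Fin Nx) ℝ)) *ᵥ u - vkron α uprev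
          + vkron β vprev ∧
      (Aτ ⊗ₖ Mh) *ᵥ v + (Mτ ⊗ₖ Ah) *ᵥ u
        = (Mτ ⊗ₖ Mh) *ᵥ f - vkron β (Mh *ᵥ ghat) + vkron β (Ah *ᵥ uprev)
          + vkron α (Mh *ᵥ vprev)) ↔
    ((Mτ ⊗ₖ Ah + (Aτ * Mτ⁻¹ * Aτ) ⊗ₖ Mh) *ᵥ u
        = (Mτ ⊗ₖ Mh) *ᵥ f - vkron β (Mh *ᵥ ghat) + vkron β (Ah *ᵥ uprev)
          + vkron ((Aτ * Mτ⁻¹) *ᵥ α) (Mh *ᵥ uprev)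
          + vkron (α - (Aτ * Mτ⁻¹) *ᵥ β) (Mh *ᵥ vprev) ∧
      v = ((Mτ⁻¹ * Aτ) ⊗ₖ (1 : Matrix (Fin Nx) (Fin Nx) ℝ)) *ᵥ u
          - vkron (Mτ⁻¹ *ᵥ α) uprev + vkron (Mτ⁻¹ *ᵥ β) vprev) := by
  rw [kronecker_one_mulVec_eq_iff hMτ, and_comm]
  simp only [mulVec_add, mulVec_sub, mulVec_mulVec, ← mul_kronecker_mul,
    kronecker_mulVec_vkron, one_mulVec, mul_one]
  refine and_congr_left fun hv => ?_
  subst hv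
  simp only [mulVec_add, mulVec_sub, mulVec_mulVec, ← mul_kronecker_mul,
    kronecker_mulVec_vkron, add_mulVec, sub_vkron, mul_one, ← Matrix.mul_assoc]
  constructor <;> intro h <;> linear_combination h
end

section
/- Let M_τ, A_τ ∈ ℝ^{N_t×N_t} with M_τ invertible, α, β ∈ ℝ^{N_t}, and set r := e_{N_t}ᵀ M_τ⁻¹ ∈ ℝ^{1×N_t}, so that g := r β and z := r α are scalars. Suppose p_0, q_0 ∈ ℝ^{N_x} are given, and for j = 1, …, c the vectors u_j, v_j ∈ ℝ^{N_t·N_x} satisfy the velocity update v_j = (M_τ⁻¹ A_τ ⊗ I_{N_x}) u_j − (M_τ⁻¹ α) ⊗ p_{j-1} + (M_τ⁻¹ β) ⊗ q_{j-1}, where p_j := u_j^{N_t} and q_j := v_j^{N_t} for j ≥ 1. Then for every j = 1, …, c the final velocity value satisfies the closed form q_j = Σ_{i=1}^{j} g^{j−i} · ( ((r A_τ) ⊗ I_{N_x}) u_i − z · p_{i-1} ) + g^{j} · q_0. -/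
open Matrix Kronecker

/-- The last temporal index. -/
def lastIdx (m : ℕ) (h : 0 < m) : Fin m := ⟨m - 1, Nat.sub_lt h Nat.one_pos⟩

/-- The last temporal block `u^{N_t}` of a stacked space-time vector. -/
def lastBlock {m n : ℕ} (h : 0 < m) (u : Fin m × Fin n → ℝ) : Fin n → ℝ :=
  fun x => u (lastIdx m h, x)

/-- `(a ⊗ I_{N_x}) u` for a row vector `a ∈ ℝ^{1×N_t}` applied to a stacked space-time
vector `u ∈ ℝ^{N_t·N_x}`, yielding the spatial vector `Σ_t a_t u^t`. -/
def rowKron {m n : ℕ} (a : Fin m → ℝ) (u : Fin m × Fin n → ℝ) : Fin n → ℝ :=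
  fun x => ∑ t, a t * u (t, x)

theorem lastBlock_sub {m n : ℕ} (h : 0 < m) (u w : Fin m × Fin n → ℝ) :
    lastBlock h (u - w) = lastBlock h u - lastBlock h w := rfl

theorem lastBlock_add {m n : ℕ} (h : 0 < m) (u w : Fin m × Fin n → ℝ) :
    lastBlock h (u + w) = lastBlock h u + lastBlock h w := rfl

theorem lastBlock_vkron {m n : ℕ} (h : 0 < m) (a : Fin m → ℝ) (w : Fin n → ℝ) :
    lastBlock h (vkron a w) = a (lastIdx m h) • w := rfl

theorem lastBlock_kronecker_one_mulVec {m n : ℕ} (h : 0 < m) (P : Matrix (Fin m) (Fin m) ℝ)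
    (u : Fin m × Fin n → ℝ) :
    lastBlock h ((P ⊗ₖ (1 : Matrix (Fin n) (Fin n) ℝ)) *ᵥ u) =
      rowKron (P (lastIdx m h)) u := by
  ext x
  simp [lastBlock, rowKron, Matrix.mulVec, dotProduct, Fintype.sum_prod_type,
    Matrix.one_apply]

/-- Closed form of an affine recurrence `x j = f j + g • x (j - 1)` on `1 ≤ j ≤ c`. -/
theorem affine_recurrence_closed_form {R E : Type*} [CommSemiring R] [AddCommMonoid E]
    [Module R E] (c : ℕ) (g : R) (f x : ℕ → E)
    (hx : ∀ j, 1 ≤ j → j ≤ c → x j = f j + g • x (j - 1)) (j : ℕ) (hj : j ≤ c) :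
    x j = (∑ i ∈ Finset.Icc 1 j, g ^ (j - i) • f i) + g ^ j • x 0 := by
  induction j with
  | zero => simp
  | succ k ih =>
    have hsum : ∑ i ∈ Finset.Icc 1 k, g ^ (k + 1 - i) • f i =
        g • ∑ i ∈ Finset.Icc 1 k, g ^ (k - i) • f i := by
      rw [Finset.smul_sum]
      refine Finset.sum_congr rfl fun i hi => ?_
      rw [Nat.sub_add_comm (Finset.mem_Icc.mp hi).2, pow_succ', mul_smul]
    rw [hx (k + 1) (by omega) hj, Nat.add_sub_cancel, ih (by omega),
      Finset.sum_Icc_succ_top (by omega), hsum, smul_add, ← mul_smul, ← pow_succ',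
      Nat.sub_self, pow_zero, one_smul, ← add_assoc, add_comm (f (k + 1))]

/-- Closed form for the endpoint velocity values `q_j = v_j^{N_t}` of the CG(p)–CGP(k)
space-time discretization of the acoustic wave equation, recursively defined from the
displacements via the velocity update (paper eq. (24a)); this is the induction the
paper performs to derive the multi-step system (paper eq. (26)). -/
theorem endpoint_velocity_closed_form
    (Nt Nx c : ℕ) (hNt : 0 < Nt)
    (Mτ Aτ : Matrix (Fin Nt) (Fin Nt) ℝ) (hMτ : IsUnit Mτ.det)
    (α β : Fin Nt → ℝ)
    (u v : ℕ → Fin Nt × Fin Nx → ℝ)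
    (p q : ℕ → Fin Nx → ℝ)
    (hp : ∀ j, 1 ≤ j → p j = lastBlock hNt (u j))
    (hq : ∀ j, 1 ≤ j → q j = lastBlock hNt (v j))
    (hupd : ∀ j, 1 ≤ j → j ≤ c →
      v j = ((Mτ⁻¹ * Aτ) ⊗ₖ (1 : Matrix (Fin Nx) (Fin Nx) ℝ)) *ᵥ u j
          - vkron (Mτ⁻¹ *ᵥ α) (p (j - 1)) + vkron (Mτ⁻¹ *ᵥ β) (q (j - 1))) :
    let e : Fin Nt → ℝ := Pi.single (lastIdx Nt hNt) 1
    let r : Fin Nt → ℝ := e ᵥ* Mτ⁻¹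
    let g : ℝ := r ⬝ᵥ β
    let z : ℝ := r ⬝ᵥ α
    ∀ j, 1 ≤ j → j ≤ c →
      q j = (∑ i ∈ Finset.Icc 1 j,
              g ^ (j - i) • (rowKron (r ᵥ* Aτ) (u i) - z • p (i - 1)))
            + g ^ j • q 0 := by
  intro e r g z j _ hj
  have hr : r = Mτ⁻¹ (lastIdx Nt hNt) := Matrix.single_one_vecMul _ _
  have hrA : (Mτ⁻¹ * Aτ) (lastIdx Nt hNt) = r ᵥ* Aτ := by
    rw [hr]; rfl
  have hg : (Mτ⁻¹ *ᵥ β) (lastIdx Nt hNt) = g := by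
    simp only [g, hr]; rfl
  have hz : (Mτ⁻¹ *ᵥ α) (lastIdx Nt hNt) = z := by
    simp only [z, hr]; rfl
  refine affine_recurrence_closed_form c g
    (fun i => rowKron (r ᵥ* Aτ) (u i) - z • p (i - 1)) q (fun k hk hkc => ?_) j hj
  rw [hq k hk, hupd k hk hkc, lastBlock_add, lastBlock_sub, lastBlock_vkron,
    lastBlock_vkron, lastBlock_kronecker_one_mulVec, hrA, hg, hz]
end

section
/- Let M_τ, A_τ ∈ ℝ^{N_t×N_t} with M_τ invertible, M_h, A_h ∈ ℝ^{N_x×N_x}, α, β ∈ ℝ^{N_t}; set r := e_{N_t}ᵀ M_τ⁻¹, g := r β, z := r α (scalars), α_{A_τ} := α − A_τ M_τ⁻¹ β ∈ ℝ^{N_t}, and S := M_τ ⊗ A_h + (A_τ M_τ⁻¹ A_τ) ⊗ M_h. Suppose p_0, q_0 ∈ ℝ^{N_x}, data f_j ∈ ℝ^{N_t·N_x} and f̂_{j-1} ∈ ℝ^{N_x} are given, and for j = 1, …, c the pairs (u_j, v_j) satisfy, with p_j := u_j^{N_t} and q_j := v_j^{N_t} for j ≥ 1, the coupled step equations (M_τ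 ⊗ I_{N_x}) v_j = (A_τ ⊗ I_{N_x}) u_j − α ⊗ p_{j-1} + β ⊗ q_{j-1} and (A_τ ⊗ M_h) v_j + (M_τ ⊗ A_h) u_j = (M_τ ⊗ M_h) f_j − β ⊗ (M_h f̂_{j-1}) + β ⊗ (A_h p_{j-1}) + α ⊗ (M_h q_{j-1}). Then for every j = 2, …, c the displacement u_j satisfies the block lower-triangular row identity S u_j = (M_τ ⊗ M_h) f_j − β ⊗ (M_h f̂_{j-1}) + β ⊗ (A_h u_{j-1}^{N_t}) + (A_τ M_τ⁻¹ α) ⊗ (M_h u_{j-1}^{N_t}) + Σ_{i=1}^{j-1} g^{j−1−i} · ( α_{A_τ} ⊗ (M_h (((r A_τ) ⊗ I_{N_x}) u_i)) − z · α_{A_τ} ⊗ (M_h p_{i-1}) ) + g^{j−1} · α_{A_τ} ⊗ (M_h q_0), where p_{i-1} = u_{i-1}^{N_t} for i ≥ 2 and p_0 is the given initial value; i.e., S u_j depends on all previous displacements u_1, …, u_{j-1}, with the block coupling u_j to u_i (i < j − 1) equal to −C_{j,i} + D_{j,i}, C_{j,i} := g^{j−i−1} (α_{A_τ} (r A_τ))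 ⊗ M_h and D_{j,i} := g^{j−i−2} z (α_{A_τ} e_{N_t}ᵀ) ⊗ M_h. -/
open Matrix Kronecker

theorem vkron_add_right {m n : ℕ} (a : Fin m → ℝ) (w w' : Fin n → ℝ) :
    vkron a (w + w') = vkron a w + vkron a w' := by
  ext; simp only [vkron, Pi.add_apply]; ring

theorem vkron_sub_left {m n : ℕ} (a a' : Fin m → ℝ) (w : Fin n → ℝ) :
    vkron (a - a') w = vkron a w - vkron a' w := by
  ext; simp only [vkron, Pi.sub_apply]; ring

theorem vkron_smul_right {m n : ℕ} (k : ℝ) (a : Fin m → ℝ) (w : Fin n → ℝ) :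
    vkron a (k • w) = k • vkron a w := by
  ext; simp only [vkron, Pi.smul_apply, smul_eq_mul]; ring

theorem rowKron_add {m n : ℕ} (a : Fin m → ℝ) (u u' : Fin m × Fin n → ℝ) :
    rowKron a (u + u') = rowKron a u + rowKron a u' := by
  ext; simp only [rowKron, Pi.add_apply, mul_add, Finset.sum_add_distrib]

theorem rowKron_sub {m n : ℕ} (a : Fin m → ℝ) (u u' : Fin m × Fin n → ℝ) :
    rowKron a (u - u') = rowKron a u - rowKron a u' := by
  ext; simp only [rowKron, Pi.sub_apply, mul_sub, Finset.sum_sub_distrib]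

theorem rowKron_vkron {m n : ℕ} (a b : Fin m → ℝ) (w : Fin n → ℝ) :
    rowKron a (vkron b w) = (a ⬝ᵥ b) • w := by
  ext; simp only [rowKron, vkron, dotProduct, Pi.smul_apply, smul_eq_mul, Finset.sum_mul, mul_assoc]

theorem rowKron_kronecker_one_mulVec {m n : ℕ} (a : Fin m → ℝ) (P : Matrix (Fin m) (Fin m) ℝ)
    (u : Fin m × Fin n → ℝ) :
    rowKron a ((P ⊗ₖ (1 : Matrix (Fin n) (Fin n) ℝ)) *ᵥ u) = rowKron (a ᵥ* P) u := by
  ext x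
  simp only [rowKron, mulVec, vecMul, dotProduct, kroneckerMap_apply, Fintype.sum_prod_type,
    one_apply, mul_ite, mul_one, mul_zero, ite_mul, zero_mul, Finset.sum_ite_eq, Finset.mem_univ,
    if_true, Finset.mul_sum, Finset.sum_mul]
  rw [Finset.sum_comm]
  exact Finset.sum_congr rfl fun _ _ => Finset.sum_congr rfl fun _ _ => by ring

theorem rowKron_single_lastIdx {m n : ℕ} (h : 0 < m) (u : Fin m × Fin n → ℝ) :
    rowKron (Pi.single (lastIdx m h) 1) u = lastBlock h u := by
  ext; simp [rowKron, lastBlock, Pi.single_apply]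

/-- The solution of the affine recursion `q j = b j + g • q (j - 1)`. -/
theorem eq_sum_pow_smul_of_affine_rec {V : Type*} [AddCommGroup V] [Module ℝ V] (g : ℝ)
    (q b : ℕ → V) (c : ℕ) (h : ∀ j, 1 ≤ j → j ≤ c → q j = b j + g • q (j - 1)) (j : ℕ)
    (hj : j ≤ c) :
    q j = ∑ i ∈ Finset.Icc 1 j, g ^ (j - i) • b i + g ^ j • q 0 := by
  induction j with
  | zero => simp
  | succ k ih =>
    rw [h (k + 1) (by omega) hj, Nat.add_sub_cancel, ih (by omega),
      Finset.sum_Icc_succ_top (by omega), smul_add, Finset.smul_sum, smul_smul, ← pow_succ',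
      Nat.sub_self, pow_zero, one_smul]
    have : ∀ i ∈ Finset.Icc 1 k, g • g ^ (k - i) • b i = g ^ (k + 1 - i) • b i := fun i hi => by
      rw [smul_smul, ← pow_succ', Nat.sub_add_comm (Finset.mem_Icc.1 hi).2]
    rw [Finset.sum_congr rfl this]
    abel

/-- Derivation of the all-at-once system for `c` consecutive time steps of the
CG(p)–CGP(k) discretization of the acoustic wave equation (paper eqs. (24)–(27)):
because the velocity is defined recursively, eliminating it yields block rows in which
`S u_j` depends on all previous displacements `u_1, …, u_{j-1}`, the coupling to `u_i`
for `i < j-1` being the strictly-lower blocks `E_{j,i} = −C_{j,i} + D_{j,i}` with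
`C_{j,i} = g^{j−i−1} (α_{A_τ} (r A_τ)) ⊗ M_h` and
`D_{j,i} = g^{j−i−2} z (α_{A_τ} e_{N_t}ᵀ) ⊗ M_h`. -/
theorem allAtOnce_wave_cgp
    (Nt Nx c : ℕ) (hNt : 0 < Nt)
    (Mτ Aτ : Matrix (Fin Nt) (Fin Nt) ℝ) (hMτ : IsUnit Mτ.det)
    (Mh Ah : Matrix (Fin Nx) (Fin Nx) ℝ)
    (α β : Fin Nt → ℝ)
    (u v f : ℕ → Fin Nt × Fin Nx → ℝ)
    (fhat : ℕ → Fin Nx → ℝ)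
    (p q : ℕ → Fin Nx → ℝ)
    (hp : ∀ j, 1 ≤ j → p j = lastBlock hNt (u j))
    (hq : ∀ j, 1 ≤ j → q j = lastBlock hNt (v j))
    (hstep : ∀ j, 1 ≤ j → j ≤ c →
      (Mτ ⊗ₖ (1 : Matrix (Fin Nx) (Fin Nx) ℝ)) *ᵥ v j
          = (Aτ ⊗ₖ (1 : Matrix (Fin Nx) (Fin Nx) ℝ)) *ᵥ u j - vkron α (p (j - 1))
            + vkron β (q (j - 1)) ∧
        (Aτ ⊗ₖ Mh) *ᵥ v j + (Mτ ⊗ₖ Ah) *ᵥ u j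
          = (Mτ ⊗ₖ Mh) *ᵥ f j - vkron β (Mh *ᵥ fhat (j - 1))
            + vkron β (Ah *ᵥ p (j - 1)) + vkron α (Mh *ᵥ q (j - 1))) :
    let e : Fin Nt → ℝ := Pi.single (lastIdx Nt hNt) 1
    let r : Fin Nt → ℝ := e ᵥ* Mτ⁻¹
    let g : ℝ := r ⬝ᵥ β
    let z : ℝ := r ⬝ᵥ α
    let αA : Fin Nt → ℝ := α - (Aτ * Mτ⁻¹) *ᵥ β
    let S : Matrix (Fin Nt × Fin Nx) (Fin Nt × Fin Nx) ℝ :=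
      Mτ ⊗ₖ Ah + (Aτ * Mτ⁻¹ * Aτ) ⊗ₖ Mh
    ∀ j, 2 ≤ j → j ≤ c →
      S *ᵥ u j
        = (Mτ ⊗ₖ Mh) *ᵥ f j - vkron β (Mh *ᵥ fhat (j - 1))
          + vkron β (Ah *ᵥ lastBlock hNt (u (j - 1)))
          + vkron ((Aτ * Mτ⁻¹) *ᵥ α) (Mh *ᵥ lastBlock hNt (u (j - 1)))
          + (∑ i ∈ Finset.Icc 1 (j - 1),
              g ^ (j - 1 - i) •
                (vkron αA (Mh *ᵥ rowKron (r ᵥ* Aτ) (u i))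
                  - z • vkron αA (Mh *ᵥ p (i - 1))))
          + g ^ (j - 1) • vkron αA (Mh *ᵥ q 0) := by
  intro e r g z αA S j hj2 hjc
  have hinv : Mτ⁻¹ * Mτ = 1 := nonsing_inv_mul Mτ hMτ
  have hrM : r ᵥ* Mτ = e := by
    simp only [r, vecMul_vecMul, hinv, vecMul_one]
  have hrec : ∀ i, 1 ≤ i → i ≤ c →
      q i = (rowKron (r ᵥ* Aτ) (u i) - z • p (i - 1)) + g • q (i - 1) := by
    intro i hi hic
    have h := congrArg (rowKron r) (hstep i hi hic).1
    rw [rowKron_add, rowKron_sub, rowKron_kronecker_one_mulVec, rowKron_kronecker_one_mulVec,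
      rowKron_vkron, rowKron_vkron, hrM, rowKron_single_lastIdx, ← hq i hi] at h
    exact h
  have hqsum := eq_sum_pow_smul_of_affine_rec g q _ c hrec (j - 1) (by omega)
  have hvel : (Aτ ⊗ₖ Mh) *ᵥ v j = ((Aτ * Mτ⁻¹ * Aτ) ⊗ₖ Mh) *ᵥ u j
      - vkron ((Aτ * Mτ⁻¹) *ᵥ α) (Mh *ᵥ p (j - 1))
      + vkron ((Aτ * Mτ⁻¹) *ᵥ β) (Mh *ᵥ q (j - 1)) := by
    have h := congrArg (((Aτ * Mτ⁻¹) ⊗ₖ Mh) *ᵥ ·) (hstep j (by omega) hjc).1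
    simpa only [mulVec_add, mulVec_sub, mulVec_mulVec, ← mul_kronecker_mul, mul_one,
      Matrix.mul_assoc, hinv, kronecker_mulVec_vkron] using h
  have hlast : vkron αA (Mh *ᵥ q (j - 1)) =
      (∑ i ∈ Finset.Icc 1 (j - 1), g ^ (j - 1 - i) •
        (vkron αA (Mh *ᵥ rowKron (r ᵥ* Aτ) (u i)) - z • vkron αA (Mh *ᵥ p (i - 1))))
      + g ^ (j - 1) • vkron αA (Mh *ᵥ q 0) := by
    let L : (Fin Nx → ℝ) →ₗ[ℝ] (Fin Nt × Fin Nx → ℝ) :=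
      { toFun := fun w => vkron αA (Mh *ᵥ w)
        map_add' := fun _ _ => by rw [mulVec_add, vkron_add_right]
        map_smul' := fun _ _ => by rw [mulVec_smul, vkron_smul_right, RingHom.id_apply] }
    have h := congrArg L hqsum
    simp only [map_add, map_sum, map_smul, map_sub] at h
    exact h
  have hdisp := (hstep j (by omega) hjc).2
  rw [hvel] at hdisp
  rw [← hp (j - 1) (by omega), add_assoc _ (∑ i ∈ _, _), ← hlast]
  simp only [S, αA, add_mulVec, vkron_sub_left]
  linear_combination hdisp
end
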